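/- arXiv:1610.01216 — 2 statements merged into one kernel-verified Lean document; each statement's English description precedes it below -/
import Mathlib

section
/- Let n ≥ 1 and let u, v : ℝ × ℝⁿ → ℝ³ be such that u is twice continuously differentiable, v is continuously differentiable in t, |u(t,x)| = 1 for all (t,x), and ∂_t u = u × v pointwise. Then the following identity holds pointwise: ∂_t²u − Δu = u(∇u·∇u − ∂_t u·∂_t u) + (v − (u·v)u)(u·v) + u × ∂_t v − u × (u × (−Δu)), where Δ is the spatial Laplacian. (This is the passage from the half-wave map equation ∂_t u = u × (−Δ)^{1/2}u, with v = (−Δ)^{1/2}u, to the nonlinear wave equation, since in that case ∂_t v = (−Δ)^{1/2}(u × (−Δ)^{1/2}u).) -/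
open MeasureTheory Filter Topology Complex Matrix
open scoped ENNReal

noncomputable section

abbrev Sp (n : ℕ) : Type := EuclideanSpace ℝ (Fin n)
abbrev V3 : Type := Fin 3 → ℝ

/-- Euclidean dot product on `ℝ³`. -/
def dot3 (u v : V3) : ℝ := ∑ i, u i * v i

/-- Cross product on `ℝ³`. -/
def cross3 (u v : V3) : V3 := crossProduct u v

/-- Time derivative `∂_t u` of a spacetime function. -/
def dt {n : ℕ} (u : ℝ × Sp n → V3) (z : ℝ × Sp n) : V3 :=
  fderiv ℝ u z ((1 : ℝ), (0 : Sp n))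

/-- Spatial partial derivative `∂_j u` of a spacetime function. -/
def dsp {n : ℕ} (j : Fin n) (u : ℝ × Sp n → V3) (z : ℝ × Sp n) : V3 :=
  fderiv ℝ u z ((0 : ℝ), EuclideanSpace.single j (1 : ℝ))

/-- Second time derivative `∂_t² u`. -/
def dtt {n : ℕ} (u : ℝ × Sp n → V3) (z : ℝ × Sp n) : V3 :=
  fderiv ℝ (fun w => dt u w) z ((1 : ℝ), (0 : Sp n))

/-- Spatial Laplacian `Δu` of a spacetime function. -/
def lap {n : ℕ} (u : ℝ × Sp n → V3) (z : ℝ × Sp n) : V3 :=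
  ∑ j : Fin n, fderiv ℝ (fun w => dsp j u w) z ((0 : ℝ), EuclideanSpace.single j (1 : ℝ))
theorem hasDerivAt_dot3 {f g : ℝ → V3} {f' g' : V3} {t : ℝ}
    (hf : HasDerivAt f f' t) (hg : HasDerivAt g g' t) :
    HasDerivAt (fun s => dot3 (f s) (g s)) (dot3 f' (g t) + dot3 (f t) g') t := by
  rw [hasDerivAt_pi] at hf hg
  unfold dot3
  rw [← Finset.sum_add_distrib]
  exact HasDerivAt.fun_sum fun i _ => (hf i).mul (hg i)

theorem hasDerivAt_cross3 {f g : ℝ → V3} {f' g' : V3} {t : ℝ}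
    (hf : HasDerivAt f f' t) (hg : HasDerivAt g g' t) :
    HasDerivAt (fun s => cross3 (f s) (g s)) (cross3 f' (g t) + cross3 (f t) g') t := by
  rw [hasDerivAt_pi] at hf hg ⊢
  intro i
  fin_cases i <;> simp only [cross3, cross_apply, Pi.add_apply]
  · exact (((hf 1).mul (hg 2)).sub ((hf 2).mul (hg 1))).congr_deriv (by simp; ring)
  · exact (((hf 2).mul (hg 0)).sub ((hf 0).mul (hg 2))).congr_deriv (by simp; ring)
  · exact (((hf 0).mul (hg 1)).sub ((hf 1).mul (hg 0))).congr_deriv (by simp; ring)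

theorem hasDerivAt_comp_line {E : Type*} [NormedAddCommGroup E] [NormedSpace ℝ E]
    {f : E → V3} (hf : Differentiable ℝ f) (z e : E) :
    HasDerivAt (fun s : ℝ => f (z + s • e)) (fderiv ℝ f z e) 0 :=
  (hf z).hasFDerivAt.hasLineDerivAt e

theorem dot3_fderiv_eq_zero {E : Type*} [NormedAddCommGroup E] [NormedSpace ℝ E]
    {u : E → V3} (hu : Differentiable ℝ u) (husph : ∀ z, dot3 (u z) (u z) = 1) (z e : E) :
    dot3 (u z) (fderiv ℝ u z e) = 0 := by
  have h := hasDerivAt_comp_line hu z e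
  have h2 := hasDerivAt_dot3 h h
  simp only [husph, zero_smul, add_zero] at h2
  have h3 := h2.unique (hasDerivAt_const 0 1)
  simp only [dot3, Fin.sum_univ_three] at h3 ⊢
  linarith

theorem differentiable_fderiv_apply {E : Type*} [NormedAddCommGroup E] [NormedSpace ℝ E]
    {u : E → V3} (hu : ContDiff ℝ 2 u) (e : E) :
    Differentiable ℝ (fun w => fderiv ℝ u w e) := by
  have h : ContDiff ℝ 1 (fderiv ℝ u) := hu.fderiv_right (by norm_num)
  exact (h.differentiable one_ne_zero).clm_apply (differentiable_const e)

theorem dot3_fderiv_fderiv {E : Type*} [NormedAddCommGroup E] [NormedSpace ℝ E]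
    {u : E → V3} (hu : ContDiff ℝ 2 u) (husph : ∀ z, dot3 (u z) (u z) = 1) (z e : E) :
    dot3 (u z) (fderiv ℝ (fun w => fderiv ℝ u w e) z e) =
      -dot3 (fderiv ℝ u z e) (fderiv ℝ u z e) := by
  have hd : Differentiable ℝ u := hu.differentiable two_ne_zero
  have h := hasDerivAt_dot3 (hasDerivAt_comp_line hd z e)
    (hasDerivAt_comp_line (differentiable_fderiv_apply hu e) z e)
  simp only [dot3_fderiv_eq_zero hd husph, zero_smul, add_zero] at h
  linarith [h.unique (hasDerivAt_const 0 0)]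

theorem dot3_sum {ι : Type*} (s : Finset ι) (a : V3) (f : ι → V3) :
    dot3 a (∑ j ∈ s, f j) = ∑ j ∈ s, dot3 a (f j) :=
  dotProduct_sum a s f

theorem dot3_lap {n : ℕ} {u : ℝ × Sp n → V3} (hu : ContDiff ℝ 2 u)
    (husph : ∀ z, dot3 (u z) (u z) = 1) (z : ℝ × Sp n) :
    dot3 (u z) (lap u z) = -∑ j : Fin n, dot3 (dsp j u z) (dsp j u z) := by
  rw [lap, dot3_sum, ← Finset.sum_neg_distrib]
  exact Finset.sum_congr rfl fun j _ => dot3_fderiv_fderiv hu husph z _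

theorem dtt_eq_of_dt_eq_cross3 {n : ℕ} {u v : ℝ × Sp n → V3} (hu : ContDiff ℝ 2 u)
    (hv : ∀ x : Sp n, ContDiff ℝ 1 (fun t : ℝ => v (t, x)))
    (heq : ∀ z, dt u z = cross3 (u z) (v z)) (z : ℝ × Sp n) :
    dtt u z = cross3 (dt u z) (v z) +
      cross3 (u z) (deriv (fun s : ℝ => v (s, z.2)) z.1) := by
  have hcurve : HasDerivAt (fun s : ℝ => (s, z.2)) ((1 : ℝ), (0 : Sp n)) z.1 :=
    (hasDerivAt_id z.1).prodMk (hasDerivAt_const z.1 z.2)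
  have hut : HasDerivAt (fun s : ℝ => u (s, z.2)) (dt u z) z.1 :=
    ((hu.differentiable two_ne_zero) z).hasFDerivAt.comp_hasDerivAt z.1 hcurve
  have hutt : HasDerivAt (fun s : ℝ => dt u (s, z.2)) (dtt u z) z.1 := by
    have hdt : HasFDerivAt (dt u) (fderiv ℝ (dt u) z) z :=
      (differentiable_fderiv_apply hu ((1 : ℝ), (0 : Sp n)) z).hasFDerivAt
    exact hdt.comp_hasDerivAt z.1 hcurve
  have hvt := (((hv z.2).differentiable one_ne_zero) z.1).hasDerivAt
  simp only [heq (_, _)] at hutt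
  exact hutt.unique (hasDerivAt_cross3 hut hvt)

theorem cross3_cross3_left (a b c : V3) :
    cross3 (cross3 a b) c = dot3 a c • b - dot3 b c • a := by
  ext i
  fin_cases i <;> simp [cross3, cross_apply, dot3, Fin.sum_univ_three] <;> ring

theorem cross3_cross3_right (a b c : V3) :
    cross3 a (cross3 b c) = dot3 a c • b - dot3 a b • c := by
  ext i
  fin_cases i <;> simp [cross3, cross_apply, dot3, Fin.sum_univ_three] <;> ring

theorem dot3_cross3_cross3 (a b : V3) :
    dot3 (cross3 a b) (cross3 a b) = dot3 a a * dot3 b b - dot3 a b ^ 2 := by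
  simp [cross3, cross_apply, dot3, Fin.sum_univ_three]
  ring

theorem dot3_neg (a b : V3) : dot3 a (-b) = -dot3 a b :=
  dotProduct_neg a b

/-- Passage from the half-wave map equation `∂_t u = u × v` to the
nonlinear wave equation. -/
theorem halfwave_to_wave_equation (n : ℕ) (hn : 1 ≤ n)
    (u v : ℝ × Sp n → V3)
    (hu : ContDiff ℝ 2 u)
    (hv : ∀ x : Sp n, ContDiff ℝ 1 (fun t : ℝ => v (t, x)))
    (husph : ∀ z, dot3 (u z) (u z) = 1)
    (heq : ∀ z, dt u z = cross3 (u z) (v z)) :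
    ∀ z : ℝ × Sp n,
      dtt u z - lap u z =
        ((∑ j : Fin n, dot3 (dsp j u z) (dsp j u z)) - dot3 (dt u z) (dt u z)) • u z
        + (dot3 (u z) (v z)) • (v z - (dot3 (u z) (v z)) • u z)
        + cross3 (u z) (deriv (fun s : ℝ => v (s, z.2)) z.1)
        - cross3 (u z) (cross3 (u z) (-(lap u z))) := by
  intro z
  have hL := dot3_lap hu husph z
  rw [dtt_eq_of_dt_eq_cross3 hu hv heq, heq z, cross3_cross3_left, cross3_cross3_right,
    dot3_cross3_cross3, dot3_neg, hL, husph z]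
  module

end
end

section
/- Let u, v, w : ℝ × ℝⁿ → ℝ³ with u twice continuously differentiable, v continuously differentiable in t, |u(t,x)| = 1 for all (t,x), and suppose u solves the nonlinear wave equation ∂_t²u − Δu = u(∇u·∇u − ∂_t u·∂_t u) + (v − (u·v)u)(u·v) + u × w − u × (u × (−Δu)) pointwise. Define X := ∂_t u − u × v and Z := ∂_t v − w. Then pointwise ∂_t X = −X × v − u × Z − u(X·(u × v + ∂_t u)). (In the paper v = (−Δ)^{1/2}u and w = (−Δ)^{1/2}(u × (−Δ)^{1/2}u), so Z = (−Δ)^{1/2}X and this is the evolution equation ∂_t X = −X × (−Δ)^{1/2}u − u × (−Δ)^{1/2}X − u(X·(u × (−Δ)^{1/2}u + ∂_t u)) used to show that solutions of the wave formulation with matched data solve the half-wave map equation.) -/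
open MeasureTheory Filter Topology Complex Matrix
open scoped ENNReal

noncomputable section

theorem fderiv_dot3_apply {E : Type*} [NormedAddCommGroup E] [NormedSpace ℝ E] {f g : E → V3}
    {z : E} (hf : DifferentiableAt ℝ f z) (hg : DifferentiableAt ℝ g z) (e : E) :
    fderiv ℝ (fun y => dot3 (f y) (g y)) z e =
      dot3 (fderiv ℝ f z e) (g z) + dot3 (f z) (fderiv ℝ g z e) := by
  have hf' := fun i => (hasFDerivAt_pi'.1 hf.hasFDerivAt) i
  have hg' := fun i => (hasFDerivAt_pi'.1 hg.hasFDerivAt) i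
  have h := HasFDerivAt.fun_sum (u := Finset.univ) fun i _ => (hf' i).mul (hg' i)
  have h' : HasFDerivAt (fun y => dot3 (f y) (g y)) _ z := h
  rw [h'.fderiv]
  simp [dot3, Fin.sum_univ_three]
  ring

theorem cross3_apply_zero (a b : V3) : cross3 a b 0 = a 1 * b 2 - a 2 * b 1 := by
  simp [cross3, cross_apply]

theorem cross3_apply_one (a b : V3) : cross3 a b 1 = a 2 * b 0 - a 0 * b 2 := by
  simp [cross3, cross_apply]

theorem cross3_apply_two (a b : V3) : cross3 a b 2 = a 0 * b 1 - a 1 * b 0 := by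
  simp [cross3, cross_apply]

/-- A unit-length map satisfies `f · ∂ₑ²f = -|∂ₑf|²` in every direction `e`. -/
theorem dot3_fderiv_fderiv_of_unit {E : Type*} [NormedAddCommGroup E] [NormedSpace ℝ E]
    {f : E → V3} (hf : ContDiff ℝ 2 f) (hunit : ∀ z, dot3 (f z) (f z) = 1) (z e : E) :
    dot3 (f z) (fderiv ℝ (fun y => fderiv ℝ f y e) z e) =
      -dot3 (fderiv ℝ f z e) (fderiv ℝ f z e) := by
  have hd : Differentiable ℝ f := hf.differentiable (by norm_num)
  have hd' : Differentiable ℝ (fun y => fderiv ℝ f y e) :=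
    ((hf.fderiv_right (m := 1) (by norm_num)).differentiable (by norm_num)).clm_apply
      (differentiable_const e)
  have orth : ∀ y, dot3 (f y) (fderiv ℝ f y e) = 0 := by
    intro y
    have h := fderiv_dot3_apply (hd y) (hd y) e
    simp only [hunit, fderiv_fun_const, Pi.zero_apply, _root_.zero_apply] at h
    simp only [dot3, Fin.sum_univ_three] at h ⊢
    linarith
  have h := fderiv_dot3_apply (hd z) (hd' z) e
  simp only [orth, fderiv_fun_const, Pi.zero_apply, _root_.zero_apply] at h
  linarith

theorem dot3_lap_of_unit {n : ℕ} {u : ℝ × Sp n → V3} (hu : ContDiff ℝ 2 u)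
    (hunit : ∀ z, dot3 (u z) (u z) = 1) (z : ℝ × Sp n) :
    dot3 (u z) (lap u z) = -∑ j : Fin n, dot3 (dsp j u z) (dsp j u z) := by
  have h : dot3 (u z) (lap u z) = ∑ j : Fin n, dot3 (u z)
      (fderiv ℝ (fun y => dsp j u y) z ((0 : ℝ), EuclideanSpace.single j (1 : ℝ))) := by
    simp only [dot3, lap, Finset.sum_apply, Finset.mul_sum]
    exact Finset.sum_comm
  rw [h, ← Finset.sum_neg_distrib]
  exact Finset.sum_congr rfl fun j _ => dot3_fderiv_fderiv_of_unit hu hunit z _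

theorem hasDerivAt_time_slice {n : ℕ} {f : ℝ × Sp n → V3} {z : ℝ × Sp n}
    (hf : DifferentiableAt ℝ f z) :
    HasDerivAt (fun s : ℝ => f (s, z.2)) (dt f z) z.1 :=
  HasFDerivAt.comp_hasDerivAt z.1 (f := fun s : ℝ => (s, z.2)) hf.hasFDerivAt
    ((hasDerivAt_id z.1).prodMk (hasDerivAt_const z.1 z.2))

/-- The pointwise algebra: substituting the wave equation, with `a = ∇u·∇u`, into `∂_t X`. -/
theorem halfwave_defect_algebra {u v w p q l v' : V3} {a : ℝ} (hunit : dot3 u u = 1)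
    (hl : dot3 u l = -a)
    (heq : q - l = (a - dot3 p p) • u + dot3 u v • (v - dot3 u v • u)
      + cross3 u w - cross3 u (cross3 u (-l))) :
    q - (cross3 p v + cross3 u v') =
      -(cross3 (p - cross3 u v) v) - cross3 u (v' - w)
        - (dot3 (p - cross3 u v) (cross3 u v + p)) • u := by
  simp only [dot3, Fin.sum_univ_three] at hunit hl
  ext i
  have hi := congrFun heq i
  fin_cases i <;>
    simp [dot3, cross3_apply_zero, cross3_apply_one, cross3_apply_two, Fin.sum_univ_three] at hi ⊢
  · linear_combination hi + u 0 * hl + (-(v 0 ^ 2 + v 1 ^ 2 + v 2 ^ 2) * u 0 - l 0) * hunit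
  · linear_combination hi + u 1 * hl + (-(v 0 ^ 2 + v 1 ^ 2 + v 2 ^ 2) * u 1 - l 1) * hunit
  · linear_combination hi + u 2 * hl + (-(v 0 ^ 2 + v 1 ^ 2 + v 2 ^ 2) * u 2 - l 2) * hunit

/-- The evolution equation for `X := ∂_t u − u × v` for solutions of the
nonlinear wave equation. -/
theorem evolution_of_halfwave_defect (n : ℕ)
    (u v w : ℝ × Sp n → V3)
    (hu : ContDiff ℝ 2 u)
    (hv : ∀ x : Sp n, ContDiff ℝ 1 (fun t : ℝ => v (t, x)))
    (husph : ∀ z, dot3 (u z) (u z) = 1)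
    (heq : ∀ z, dtt u z - lap u z =
      ((∑ j : Fin n, dot3 (dsp j u z) (dsp j u z)) - dot3 (dt u z) (dt u z)) • u z
      + (dot3 (u z) (v z)) • (v z - (dot3 (u z) (v z)) • u z)
      + cross3 (u z) (w z)
      - cross3 (u z) (cross3 (u z) (-(lap u z)))) :
    ∀ z : ℝ × Sp n,
      deriv (fun s : ℝ => dt u (s, z.2) - cross3 (u (s, z.2)) (v (s, z.2))) z.1 =
        -(cross3 (dt u z - cross3 (u z) (v z)) (v z))
        - cross3 (u z) (deriv (fun s : ℝ => v (s, z.2)) z.1 - w z)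
        - (dot3 (dt u z - cross3 (u z) (v z)) (cross3 (u z) (v z) + dt u z)) • u z := by
  intro z
  have hu1 : DifferentiableAt ℝ u z := hu.differentiable (by norm_num) z
  have hu2 : DifferentiableAt ℝ (fun y => dt u y) z :=
    ((hu.fderiv_right (m := 1) (by norm_num)).differentiable (by norm_num)).clm_apply
      (differentiable_const _) z
  have hvt := ((hv z.2).differentiable (by norm_num) z.1).hasDerivAt
  have hX := (hasDerivAt_time_slice hu2).sub (hasDerivAt_cross3 (hasDerivAt_time_slice hu1) hvt)
  exact hX.deriv.trans
    (halfwave_defect_algebra (husph z) (dot3_lap_of_unit hu husph z) (heq z))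

end
end
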